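/- Let p be a prime number, X a finite nonempty subset of ℚ_p, and let 𝒞 and 𝒞′ be partitions of X into nonempty subsets such that 𝒞′ refines 𝒞, i.e. every member C of 𝒞 is a union of members of 𝒞′. Then E(𝒞′) ≤ E(𝒞), where E(𝒞) = Σ_{C∈𝒞} (#C − 1)·μ(C); and if 𝒞′ ≠ 𝒞, then E(𝒞′) < E(𝒞). -/

import Mathlib

open Finset

/-- The diameter `μ(C) = max {‖x - y‖ : x, y ∈ C}` of a finite set of `p`-adic numbers
(by convention `0` for the empty set). -/
noncomputable def mu {p : ℕ} [Fact p.Prime] (C : Finset ℚ_[p]) : ℝ :=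
  if h : C.Nonempty then (C ×ˢ C).sup' (h.product h) (fun xy => ‖xy.1 - xy.2‖) else 0

/-- `𝒞` is a partition of `X` into pairwise disjoint nonempty subsets whose union is `X`. -/
def IsPartition {p : ℕ} [Fact p.Prime] (X : Finset ℚ_[p]) (𝒞 : Finset (Finset ℚ_[p])) : Prop :=
  (∀ C ∈ 𝒞, C.Nonempty) ∧
  (∀ C₁ ∈ 𝒞, ∀ C₂ ∈ 𝒞, C₁ ≠ C₂ → Disjoint C₁ C₂) ∧
  (∀ x, x ∈ X ↔ ∃ C ∈ 𝒞, x ∈ C)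

/-- The energy `E(𝒞) = Σ_{C∈𝒞} (#C - 1)·μ(C)` of a clustering `𝒞`. -/
noncomputable def energy {p : ℕ} [Fact p.Prime] (𝒞 : Finset (Finset ℚ_[p])) : ℝ :=
  ∑ C ∈ 𝒞, ((C.card : ℝ) - 1) * mu C

/-- `𝒞'` refines `𝒞`: every member of `𝒞` is a union of members of `𝒞'`. -/
def Refines {p : ℕ} [Fact p.Prime] (𝒞' 𝒞 : Finset (Finset ℚ_[p])) : Prop :=
  ∀ C ∈ 𝒞, ∃ S ⊆ 𝒞', ∀ x, x ∈ C ↔ ∃ C' ∈ S, x ∈ C'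

theorem mu_nonneg {p : ℕ} [Fact p.Prime] (C : Finset ℚ_[p]) : 0 ≤ mu C := by
  unfold mu
  split_ifs with h
  · obtain ⟨x, hx⟩ := h
    exact (norm_nonneg (x - x)).trans
      (Finset.le_sup' (fun xy : ℚ_[p] × ℚ_[p] => ‖xy.1 - xy.2‖) (Finset.mk_mem_product hx hx))
  · exact le_rfl

theorem norm_sub_le_mu {p : ℕ} [Fact p.Prime] {C : Finset ℚ_[p]} {x y : ℚ_[p]}
    (hx : x ∈ C) (hy : y ∈ C) : ‖x - y‖ ≤ mu C := by
  rw [mu, dif_pos ⟨x, hx⟩]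
  exact Finset.le_sup' (fun xy : ℚ_[p] × ℚ_[p] => ‖xy.1 - xy.2‖) (Finset.mk_mem_product hx hy)

theorem mu_mono {p : ℕ} [Fact p.Prime] {C D : Finset ℚ_[p]} (h : C ⊆ D) : mu C ≤ mu D := by
  by_cases hC : C.Nonempty
  · rw [mu, dif_pos hC]
    refine Finset.sup'_le _ _ fun xy hxy => ?_
    rw [Finset.mem_product] at hxy
    exact norm_sub_le_mu (h hxy.1) (h hxy.2)
  · rw [mu, dif_neg hC]
    exact mu_nonneg D

theorem mu_pos {p : ℕ} [Fact p.Prime] {C : Finset ℚ_[p]} (h : 1 < C.card) : 0 < mu C := by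
  obtain ⟨x, hx, y, hy, hxy⟩ := Finset.one_lt_card.mp h
  exact (norm_pos_iff.mpr (sub_ne_zero.mpr hxy)).trans_le (norm_sub_le_mu hx hy)

namespace IsPartition

variable {p : ℕ} [Fact p.Prime] {X : Finset ℚ_[p]} {𝒞 𝒞' : Finset (Finset ℚ_[p])}

theorem subset (h : IsPartition X 𝒞) {C : Finset ℚ_[p]} (hC : C ∈ 𝒞) : C ⊆ X :=
  fun x hx => (h.2.2 x).mpr ⟨C, hC, hx⟩

theorem eq_of_mem (h : IsPartition X 𝒞) {C D : Finset ℚ_[p]} (hC : C ∈ 𝒞) (hD : D ∈ 𝒞)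
    {x : ℚ_[p]} (hxC : x ∈ C) (hxD : x ∈ D) : C = D := by
  by_contra hne
  exact Finset.disjoint_left.mp (h.2.1 C hC D hD hne) hxC hxD

theorem sum_card (h : IsPartition X 𝒞) : ∑ C ∈ 𝒞, C.card = X.card := by
  classical
  have hX : X = 𝒞.biUnion id := by
    ext x
    simpa using h.2.2 x
  rw [hX, Finset.card_biUnion]
  · rfl
  · exact fun C hC D hD hne => h.2.1 C hC D hD hne

theorem card_le (h : IsPartition X 𝒞) : 𝒞.card ≤ X.card := by
  rw [← h.sum_card, Finset.card_eq_sum_ones]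
  exact Finset.sum_le_sum fun C hC => (h.1 C hC).card_pos

theorem energy_le (h : IsPartition X 𝒞) :
    energy 𝒞 ≤ ((X.card : ℝ) - 𝒞.card) * mu X := by
  calc energy 𝒞 ≤ ∑ C ∈ 𝒞, ((C.card : ℝ) - 1) * mu X := by
        refine Finset.sum_le_sum fun C hC => ?_
        have hcard : (1 : ℝ) ≤ C.card := by exact_mod_cast (h.1 C hC).card_pos
        exact mul_le_mul_of_nonneg_left (mu_mono (h.subset hC)) (by linarith)
    _ = ((X.card : ℝ) - 𝒞.card) * mu X := by
        rw [← Finset.sum_mul, Finset.sum_sub_distrib, ← h.sum_card]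
        simp

theorem card_pos (h : IsPartition X 𝒞) (hX : X.Nonempty) : 0 < 𝒞.card := by
  obtain ⟨x, hx⟩ := hX
  obtain ⟨C, hC, -⟩ := (h.2.2 x).mp hx
  exact Finset.card_pos.mpr ⟨C, hC⟩

theorem energy_le_trivial (h : IsPartition X 𝒞) (hX : X.Nonempty) :
    energy 𝒞 ≤ ((X.card : ℝ) - 1) * mu X := by
  refine h.energy_le.trans (mul_le_mul_of_nonneg_right ?_ (mu_nonneg X))
  have : (1 : ℝ) ≤ 𝒞.card := by exact_mod_cast h.card_pos hX
  linarith

theorem energy_lt_trivial (h : IsPartition X 𝒞) (hX : X.Nonempty) (hne : 𝒞 ≠ {X}) :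
    energy 𝒞 < ((X.card : ℝ) - 1) * mu X := by
  have hcard : 1 < 𝒞.card := by
    refine lt_of_le_of_ne (h.card_pos hX) fun h1 => hne ?_
    obtain ⟨C, rfl⟩ := Finset.card_eq_one.mp h1.symm
    congr 1
    ext x
    simpa using (h.2.2 x).symm
  refine h.energy_le.trans_lt (mul_lt_mul_of_pos_right ?_ (mu_pos (hcard.trans_le h.card_le)))
  have : (1 : ℝ) < 𝒞.card := by exact_mod_cast hcard
  linarith

open scoped Classical in
theorem filter_subset_of_refines (h𝒞' : IsPartition X 𝒞') (href : Refines 𝒞' 𝒞)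
    {C : Finset ℚ_[p]} (hC : C ∈ 𝒞) : IsPartition C {D ∈ 𝒞' | D ⊆ C} := by
  refine ⟨fun D hD => h𝒞'.1 D (Finset.mem_filter.mp hD).1,
    fun D hD E hE => h𝒞'.2.1 D (Finset.mem_filter.mp hD).1 E (Finset.mem_filter.mp hE).1,
    fun x => ⟨fun hx => ?_, fun ⟨D, hD, hx⟩ => (Finset.mem_filter.mp hD).2 hx⟩⟩
  obtain ⟨S, hS, hmem⟩ := href C hC
  obtain ⟨D, hD, hxD⟩ := (hmem x).mp hx
  exact ⟨D, Finset.mem_filter.mpr ⟨hS hD, fun y hy => (hmem y).mpr ⟨D, hD, hy⟩⟩, hxD⟩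

open scoped Classical in
theorem eq_biUnion_of_refines (h𝒞 : IsPartition X 𝒞) (h𝒞' : IsPartition X 𝒞')
    (href : Refines 𝒞' 𝒞) : 𝒞' = 𝒞.biUnion fun C => {D ∈ 𝒞' | D ⊆ C} := by
  ext D
  simp only [Finset.mem_biUnion, Finset.mem_filter]
  refine ⟨fun hD => ?_, fun ⟨_, _, hD, _⟩ => hD⟩
  obtain ⟨x, hx⟩ := h𝒞'.1 D hD
  obtain ⟨C, hC, hxC⟩ := (h𝒞.2.2 x).mp (h𝒞'.subset hD hx)
  obtain ⟨E, hE, hxE⟩ := ((h𝒞'.filter_subset_of_refines href hC).2.2 x).mp hxC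
  rw [Finset.mem_filter] at hE
  obtain rfl := h𝒞'.eq_of_mem hD hE.1 hx hxE
  exact ⟨C, hC, hE⟩

open scoped Classical in
theorem energy_eq_sum_of_refines (h𝒞 : IsPartition X 𝒞) (h𝒞' : IsPartition X 𝒞')
    (href : Refines 𝒞' 𝒞) : energy 𝒞' = ∑ C ∈ 𝒞, energy {D ∈ 𝒞' | D ⊆ C} := by
  conv_lhs => rw [h𝒞.eq_biUnion_of_refines h𝒞' href]
  refine Finset.sum_biUnion fun C hC E hE hne => Finset.disjoint_left.mpr fun D hDC hDE => hne ?_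
  rw [Finset.mem_filter] at hDC hDE
  obtain ⟨x, hx⟩ := h𝒞'.1 D hDC.1
  exact h𝒞.eq_of_mem hC hE (hDC.2 hx) (hDE.2 hx)

end IsPartition

/-- The energy functional is (strictly) monotonic with respect to refinement of partitions
of a finite nonempty set `X ⊆ ℚ_p`. -/
theorem energy_monotone_of_refines {p : ℕ} [Fact p.Prime]
    (X : Finset ℚ_[p]) (hX : X.Nonempty) (𝒞 𝒞' : Finset (Finset ℚ_[p]))
    (h𝒞 : IsPartition X 𝒞) (h𝒞' : IsPartition X 𝒞')
    (href : Refines 𝒞' 𝒞) :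
    energy 𝒞' ≤ energy 𝒞 ∧ (𝒞' ≠ 𝒞 → energy 𝒞' < energy 𝒞) := by
  classical
  have hle : ∀ C ∈ 𝒞, energy {D ∈ 𝒞' | D ⊆ C} ≤ ((C.card : ℝ) - 1) * mu C := fun C hC =>
    (h𝒞'.filter_subset_of_refines href hC).energy_le_trivial (h𝒞.1 C hC)
  rw [h𝒞.energy_eq_sum_of_refines h𝒞' href]
  refine ⟨Finset.sum_le_sum hle, fun hne => Finset.sum_lt_sum hle ?_⟩
  by_contra! hge
  have hsingle : ∀ C ∈ 𝒞, {D ∈ 𝒞' | D ⊆ C} = ({C} : Finset (Finset ℚ_[p])) := fun C hC => by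
    by_contra hC'
    exact (hge C hC).not_gt
      ((h𝒞'.filter_subset_of_refines href hC).energy_lt_trivial (h𝒞.1 C hC) hC')
  refine hne ((h𝒞.eq_biUnion_of_refines h𝒞' href).trans ?_)
  rw [Finset.biUnion_congr rfl hsingle, Finset.biUnion_singleton_eq_self]
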